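/- (Refined coercivity below the mountain-pass level, inverse-square potential Hartree case.) Under the setting of the previous statement, assume in addition m > 0 and fix σ < m. Then there exists ε > 0 such that for every smooth compactly supported u ≠ 0 with I[u] < 0 and S[u] ≤ σ, one has I[u] + ε ‖√K_λ u‖² ≤ −(B/4)(m − S[u]). -/

import Mathlib

open MeasureTheory

noncomputable def gradNormSq {N : ℕ} (u : EuclideanSpace ℝ (Fin N) → ℂ)
    (x : EuclideanSpace ℝ (Fin N)) : ℝ :=
  ∑ i, ‖fderiv ℝ u x (EuclideanSpace.single i 1)‖ ^ 2

/-- The quantity `‖√K_λ u‖²`. -/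
noncomputable def kineticK {N : ℕ} (lam : ℝ) (u : EuclideanSpace ℝ (Fin N) → ℂ) : ℝ :=
  (∫ x, gradNormSq u x) + lam * ∫ x, ‖u x‖ ^ 2 / ‖x‖ ^ 2

/-- The normalizing constant `c_{N,α}` of the Riesz potential. -/
noncomputable def rieszConst (N : ℕ) (α : ℝ) : ℝ :=
  Real.Gamma (((N : ℝ) - α) / 2) /
    (Real.Gamma (α / 2) * Real.pi ^ ((N : ℝ) / 2) * (2 : ℝ) ^ α)

/-- Convolution `J_α ∗ g` of the Riesz potential with a real-valued function. -/
noncomputable def rieszConvR {N : ℕ} (α : ℝ) (g : EuclideanSpace ℝ (Fin N) → ℝ)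
    (x : EuclideanSpace ℝ (Fin N)) : ℝ :=
  ∫ y, rieszConst N α * ‖x - y‖ ^ (α - (N : ℝ)) * g y

/-- The Hartree-type potential energy. -/
noncomputable def hartreeP {N : ℕ} (α τ p : ℝ) (u : EuclideanSpace ℝ (Fin N) → ℂ) : ℝ :=
  ∫ x, ‖x‖ ^ (-τ) * rieszConvR α (fun y => ‖y‖ ^ (-τ) * ‖u y‖ ^ p) x * ‖u x‖ ^ p

/-- The virial functional `I[u] := ‖√K_λ u‖² − (B/(2p)) P[u]`. -/
noncomputable def virialI {N : ℕ} (α τ lam p B : ℝ)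
    (u : EuclideanSpace ℝ (Fin N) → ℂ) : ℝ :=
  kineticK lam u - (B / (2 * p)) * hartreeP α τ p u

/-- The action `S[u] := ‖√K_λ u‖² + ‖u‖² − (1/p) P[u]`. -/
noncomputable def actionS {N : ℕ} (α τ lam p : ℝ)
    (u : EuclideanSpace ℝ (Fin N) → ℂ) : ℝ :=
  kineticK lam u + (∫ x, ‖u x‖ ^ 2) - (1 / p) * hartreeP α τ p u

/-- The mountain-pass level
`m := inf { S[v] : v smooth compactly supported, v ≠ 0, I[v] = 0 }`. -/
noncomputable def mpLevel (N : ℕ) (α τ lam p B : ℝ) : ℝ :=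
  sInf {s : ℝ | ∃ v : EuclideanSpace ℝ (Fin N) → ℂ,
    ContDiff ℝ (⊤ : ℕ∞) v ∧ HasCompactSupport v ∧ v ≠ 0 ∧
    virialI α τ lam p B v = 0 ∧ s = actionS α τ lam p v}

theorem real_core {B m σ : ℝ} (hB : 2 < B) (hσ : σ < m) :
    ∃ ε > 0, ∀ a b M : ℝ, 0 < a → 0 ≤ M → a - (B/2) * b < 0 → a + M - b ≤ σ →
      (∀ s : ℝ, 0 < s → s < 1 → s ^ (2:ℕ) * a - (B/2) * (s ^ B * b) = 0 →
        m ≤ s ^ (2:ℕ) * a + M - s ^ B * b) →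
      a - (B/2) * b + ε * a ≤ -(B/4) * (m - (a + M - b)) := by
  set c0 : ℝ := (1 - 2 / B) / 2 with hc0
  have hB0 : 0 < B := by linarith
  have h2B : 2 / B < 1 := by rw [div_lt_one hB0]; exact hB
  have hc0pos : 0 < c0 := by rw [hc0]; linarith
  have hcont : ContinuousAt (fun s : ℝ => s ^ (2 - B)) 1 :=
    Real.continuousAt_rpow_const 1 (2-B) (Or.inl one_ne_zero)
  have e1 : ∀ᶠ s : ℝ in nhds 1, c0 < 1 - 2 / B * s ^ (2 - B) := by
    have : ContinuousAt (fun s : ℝ => 1 - 2 / B * s ^ (2 - B)) 1 :=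
      continuousAt_const.sub (continuousAt_const.mul hcont)
    apply this.eventually_const_lt
    simp; linarith
  have e2 : ∀ᶠ s : ℝ in nhds 1, (|σ| / c0) * (2 / B * |s ^ (2 - B) - s ^ 2|) < m - σ := by
    have : ContinuousAt (fun s : ℝ => (|σ| / c0) * (2 / B * |s ^ (2 - B) - s ^ 2|)) 1 :=
      continuousAt_const.mul (continuousAt_const.mul
        ((hcont.sub (continuousAt_id.pow 2)).abs))
    apply this.eventually_lt_const
    simp; linarith
  obtain ⟨η, hη, H⟩ := Metric.eventually_nhds_iff.1 (e1.and e2)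
  refine ⟨(1/2) * (B/2 - 1) * η, by have : 0 < B/2 - 1 := by linarith
                                    positivity, ?_⟩
  intro a b M ha hM hI hS hm
  have hb : 0 < b := by
    by_contra h; push Not at h
    nlinarith
  -- the scale
  set q : ℝ := 2 * a / (B * b) with hq
  have hq0 : 0 < q := by positivity
  have hq1 : q < 1 := by rw [hq, div_lt_one (by positivity)]; linarith
  set s : ℝ := q ^ (1 / (B - 2)) with hs
  have hs0 : 0 < s := Real.rpow_pos_of_pos hq0 _
  have hs1 : s < 1 := Real.rpow_lt_one hq0.le hq1 (by apply one_div_pos.2; linarith)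
  have hsq : s ^ (B - 2) = q := by
    rw [hs, ← Real.rpow_mul hq0.le, one_div_mul_cancel (by linarith), Real.rpow_one]
  have hsB : s ^ B = s ^ 2 * q := by
    rw [← hsq, ← Real.rpow_natCast s 2, ← Real.rpow_add hs0]; congr 1; push_cast; ring
  have hr : s ^ (2 - B) = q⁻¹ := by
    rw [← hsq, ← Real.rpow_neg hs0.le]; congr 1; ring
  have haq : a = B / 2 * b * q := by rw [hq]; field_simp
  have hbq : b = a * (2 / B) * q⁻¹ := by rw [haq]; field_simp
  have hms := hm s hs0 hs1 (by rw [hsB, haq]; ring)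
  have hms' : m ≤ s ^ 2 * a * (1 - 2 / B) + M := by
    rw [hsB] at hms
    have : s ^ 2 * q * b = s ^ 2 * a * (2 / B) := by rw [haq]; field_simp
    linarith
  have hq1' : 1 < q⁻¹ := (one_lt_inv₀ hq0).2 hq1
  have hs2 : s ^ 2 < 1 := by nlinarith
  have hsη : s ≤ 1 - η := by
    by_contra hcon; push Not at hcon
    obtain ⟨h1, h2⟩ := H (y := s) (by rw [Real.dist_eq, abs_lt]; constructor <;> linarith)
    rw [hr] at h1 h2
    have hac : a * c0 ≤ |σ| := by
      have : a * c0 ≤ a * (1 - 2 / B * q⁻¹) := by gcongr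
      have h3 : a * (1 - 2 / B * q⁻¹) = a - b := by rw [hbq]; ring
      linarith [le_abs_self σ]
    have hac' : a ≤ |σ| / c0 := by rwa [le_div_iff₀ hc0pos]
    have h4 : a * (2 / B * |q⁻¹ - s ^ 2|) ≤ |σ| / c0 * (2 / B * |q⁻¹ - s ^ 2|) := by
      gcongr
    rw [abs_of_pos (a := q⁻¹ - s ^ 2) (by linarith)] at h4 h2
    have h5 : a * (2 / B * (q⁻¹ - s ^ 2)) = b - s ^ 2 * a * (2 / B) := by
      rw [hbq]; ring
    nlinarith
  have key : (1/2) * (B/2 - 1) * η * a ≤ (1/2) * (B/2-1) * (1 - s^2) * a := by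
    have : η ≤ 1 - s ^ 2 := by nlinarith
    have : 0 < B/2 - 1 := by linarith
    gcongr
  -- reduce to inequality with M eliminated
  have h6 : B / 4 * m ≤ B / 4 * (s ^ 2 * a * (1 - 2 / B) + M) := by gcongr
  have h7 : B / 4 * (s ^ 2 * a * (1 - 2 / B)) = s ^ 2 * a * (B / 4 - 1 / 2) := by
    field_simp; ring
  have h8 : a * 2 ≤ B * b := by linarith
  nlinarith

/-- The `L²`-preserving dilation. -/
noncomputable def dil {N : ℕ} (s : ℝ) (u : EuclideanSpace ℝ (Fin N) → ℂ) :
    EuclideanSpace ℝ (Fin N) → ℂ := fun x => (s ^ ((N:ℝ)/2)) • u (s • x)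

theorem int_dil {N : ℕ} {s : ℝ} (hs : 0 < s) (f : EuclideanSpace ℝ (Fin N) → ℝ) :
    ∫ x, f (s • x) = s ^ (-(N:ℝ)) * ∫ x, f x := by
  rw [Measure.integral_comp_smul, finrank_euclideanSpace_fin, smul_eq_mul,
    abs_of_pos (by positivity), Real.rpow_neg hs.le, Real.rpow_natCast]

theorem norm_dil {N : ℕ} {s : ℝ} (hs : 0 < s) (u : EuclideanSpace ℝ (Fin N) → ℂ)
    (x : EuclideanSpace ℝ (Fin N)) : ‖dil s u x‖ = s ^ ((N:ℝ)/2) * ‖u (s • x)‖ := by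
  rw [dil, norm_smul, Real.norm_of_nonneg (by positivity)]

theorem sq_pow_half {N : ℕ} {s : ℝ} (hs : 0 < s) : (s ^ ((N:ℝ)/2)) ^ 2 = s ^ (N:ℝ) := by
  rw [← Real.rpow_natCast (s ^ ((N:ℝ)/2)) 2, ← Real.rpow_mul hs.le]; congr 1; push_cast; ring

theorem cancelN {N : ℕ} {s : ℝ} (hs : 0 < s) : s ^ (N:ℝ) * s ^ (-(N:ℝ)) = 1 := by
  rw [← Real.rpow_add hs]; simp

theorem mass_dil {N : ℕ} {s : ℝ} (hs : 0 < s) (u : EuclideanSpace ℝ (Fin N) → ℂ) :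
    ∫ x, ‖dil s u x‖ ^ 2 = ∫ x, ‖u x‖ ^ 2 := by
  simp_rw [norm_dil hs, mul_pow, integral_const_mul]
  rw [int_dil hs (fun x => ‖u x‖ ^ 2), sq_pow_half hs, ← mul_assoc, cancelN hs, one_mul]

theorem kin_dil {N : ℕ} {s : ℝ} (hs : 0 < s) (lam : ℝ) (u : EuclideanSpace ℝ (Fin N) → ℂ) :
    kineticK lam (dil s u) = s ^ (2:ℕ) * kineticK lam u := by
  have h1 : ∀ x, gradNormSq (dil s u) x = s ^ (N:ℝ) * s ^ 2 * gradNormSq u (s • x) := by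
    intro x
    have : dil s u = (s ^ ((N:ℝ)/2)) • (fun x => u (s • x)) := rfl
    simp only [gradNormSq, this, fderiv_const_smul_field, Pi.smul_apply, fderiv_comp_smul,
      _root_.smul_apply, norm_smul, mul_pow, Finset.mul_sum, Real.norm_eq_abs, sq_abs,
      sq_pow_half hs]
    simp only [mul_assoc]
  have h2 : ∀ x, ‖dil s u x‖ ^ 2 / ‖x‖ ^ 2
      = s ^ (N:ℝ) * s ^ 2 * (‖u (s • x)‖ ^ 2 / ‖s • x‖ ^ 2) := by
    intro x
    rw [norm_dil hs, mul_pow, sq_pow_half hs, norm_smul, Real.norm_of_nonneg hs.le]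
    rcases eq_or_ne (‖x‖) 0 with h | h
    · simp [h]
    · field_simp
  unfold kineticK
  simp_rw [h1, h2, integral_const_mul]
  rw [int_dil hs (gradNormSq u), int_dil hs (fun x => ‖u x‖ ^ 2 / ‖x‖ ^ 2)]
  linear_combination (s ^ 2 * (∫ x, gradNormSq u x) +
    s ^ 2 * lam * ∫ x, ‖u x‖ ^ 2 / ‖x‖ ^ 2) * cancelN (N := N) hs

theorem norm_smul_rpow {N : ℕ} {s : ℝ} (hs : 0 < s) (e : ℝ) (x : EuclideanSpace ℝ (Fin N)) :
    ‖x‖ ^ e = s ^ (-e) * ‖s • x‖ ^ e := by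
  rw [norm_smul, Real.norm_of_nonneg hs.le, Real.mul_rpow hs.le (norm_nonneg _), ← mul_assoc,
    ← Real.rpow_add hs]; simp

theorem hartree_dil {N : ℕ} {s : ℝ} (hs : 0 < s) (α τ p : ℝ)
    (u : EuclideanSpace ℝ (Fin N) → ℂ) :
    hartreeP α τ p (dil s u) = s ^ (N * p - N - α + 2 * τ) * hartreeP α τ p u := by
  have hp : ∀ x, ‖dil s u x‖ ^ p = s ^ ((N:ℝ)/2 * p) * ‖u (s • x)‖ ^ p := by
    intro x
    rw [norm_dil hs, Real.mul_rpow (by positivity) (norm_nonneg _), ← Real.rpow_mul hs.le]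
  have hc : ∀ x, rieszConvR α (fun y => ‖y‖ ^ (-τ) * ‖dil s u y‖ ^ p) x
      = (s ^ ((N:ℝ) - α) * s ^ τ * s ^ ((N:ℝ)/2 * p) * s ^ (-(N:ℝ)))
        * rieszConvR α (fun y => ‖y‖ ^ (-τ) * ‖u y‖ ^ p) (s • x) := by
    intro x
    unfold rieszConvR
    rw [mul_assoc, ← int_dil hs (fun y => rieszConst N α * ‖s • x - y‖ ^ (α - (N : ℝ)) *
      (‖y‖ ^ (-τ) * ‖u y‖ ^ p)), ← integral_const_mul]
    congr 1; ext y
    beta_reduce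
    rw [hp, norm_smul_rpow hs (α - N) (x - y), norm_smul_rpow hs (-τ) y, smul_sub, neg_sub,
      neg_neg]
    ring
  unfold hartreeP
  have h : ∀ x, ‖x‖ ^ (-τ) * rieszConvR α (fun y => ‖y‖ ^ (-τ) * ‖dil s u y‖ ^ p) x
      * ‖dil s u x‖ ^ p = (s ^ ((N:ℝ) - α) * s ^ τ * s ^ ((N:ℝ)/2 * p) * s ^ (-(N:ℝ)) * s ^ τ
        * s ^ ((N:ℝ)/2 * p)) * (‖s • x‖ ^ (-τ) *
        rieszConvR α (fun y => ‖y‖ ^ (-τ) * ‖u y‖ ^ p) (s • x) * ‖u (s • x)‖ ^ p) := by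
    intro x
    rw [hc, hp, norm_smul_rpow hs (-τ) x, neg_neg]; ring
  simp_rw [h, integral_const_mul]
  rw [int_dil hs (fun x => ‖x‖ ^ (-τ) *
        rieszConvR α (fun y => ‖y‖ ^ (-τ) * ‖u y‖ ^ p) x * ‖u x‖ ^ p), ← mul_assoc]
  congr 1
  simp only [← Real.rpow_add hs]
  congr 1; ring

theorem dil_smooth {N : ℕ} (s : ℝ) {u : EuclideanSpace ℝ (Fin N) → ℂ}
    (hu : ContDiff ℝ (⊤ : ℕ∞) u) : ContDiff ℝ (⊤ : ℕ∞) (dil s u) := by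
  unfold dil
  exact (hu.comp (contDiff_id.const_smul s)).const_smul _

theorem dil_supp {N : ℕ} {s : ℝ} (hs : 0 < s) {u : EuclideanSpace ℝ (Fin N) → ℂ}
    (hu : HasCompactSupport u) : HasCompactSupport (dil s u) := by
  have := hu.comp_smul hs.ne'
  exact this.smul_left (f := fun _ => (s ^ ((N:ℝ)/2)))

theorem dil_ne {N : ℕ} {s : ℝ} (hs : 0 < s) {u : EuclideanSpace ℝ (Fin N) → ℂ}
    (hu : u ≠ 0) : dil s u ≠ 0 := by
  intro h
  apply hu
  ext x
  have := congrFun h (s⁻¹ • x)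
  simp only [dil, smul_smul, mul_inv_cancel₀ hs.ne', one_smul, Pi.zero_apply, smul_eq_zero] at this
  rcases this with h | h
  · exact absurd h (by positivity)
  · simpa using h

theorem inv_norm_int {N : ℕ} (hN : 3 ≤ N) (k : ℕ) (hk : k < N) (C R : ℝ) :
    Integrable ((Metric.ball (0 : EuclideanSpace ℝ (Fin N)) R).indicator
      (fun x => C / ‖x‖ ^ k)) := by
  rw [integrable_indicator_iff Metric.isOpen_ball.measurableSet]
  refine integrableOn_ball_of_norm_le_rpow (C := |C|) (α := k) ?_ ?_ ?_ ?_
  · simp; omega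
  · simpa using hk
  · apply Filter.Eventually.of_forall; intro x
    rw [Real.rpow_neg (norm_nonneg _), Real.rpow_natCast]
    simp [div_eq_mul_inv]
  · exact (by fun_prop : Measurable (fun x : EuclideanSpace ℝ (Fin N) => C / ‖x‖ ^ k)).aestronglyMeasurable

theorem grad_bound {N : ℕ} (u : EuclideanSpace ℝ (Fin N) → ℂ) (x y : EuclideanSpace ℝ (Fin N)) :
    ‖fderiv ℝ u x y‖ ^ 2 ≤ gradNormSq u x * ‖y‖ ^ 2 := by
  have h1 : y = ∑ i, y i • EuclideanSpace.single i (1:ℝ) := by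
    have := (EuclideanSpace.basisFun (Fin N) ℝ).sum_repr y
    simpa using this.symm
  have h2 : ‖fderiv ℝ u x y‖ ≤ ∑ i, ‖fderiv ℝ u x (EuclideanSpace.single i 1)‖ * |y i| := by
    conv_lhs => rw [h1, map_sum]
    refine (norm_sum_le _ _).trans (Finset.sum_le_sum fun i _ => ?_)
    rw [map_smul, norm_smul, Real.norm_eq_abs, mul_comm]
  have h3 := Finset.sum_mul_sq_le_sq_mul_sq Finset.univ
    (fun i => ‖fderiv ℝ u x (EuclideanSpace.single i 1)‖) (fun i => |y i|)
  rw [EuclideanSpace.norm_sq_eq]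
  simp only [sq_abs, Real.norm_eq_abs] at h3 ⊢
  exact (pow_le_pow_left₀ (norm_nonneg _) h2 2).trans h3

theorem grad_integrable {N : ℕ} {u : EuclideanSpace ℝ (Fin N) → ℂ}
    (hu : ContDiff ℝ (⊤ : ℕ∞) u) (hc : HasCompactSupport u) : Integrable (gradNormSq u) := by
  have hd : Continuous (fderiv ℝ u) := hu.continuous_fderiv (by simp)
  apply Continuous.integrable_of_hasCompactSupport
  · unfold gradNormSq; fun_prop
  · refine (hc.fderiv (𝕜 := ℝ)).mono' ?_
    intro x hx
    apply subset_tsupport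
    intro h
    apply hx
    simp [gradNormSq, h]

theorem hardy {N : ℕ} (hN : 3 ≤ N) {u : EuclideanSpace ℝ (Fin N) → ℂ}
    (hu : ContDiff ℝ (⊤ : ℕ∞) u) (hc : HasCompactSupport u) :
    Integrable (fun x => ‖u x‖ ^ 2 / ‖x‖ ^ 2) ∧
    ((N:ℝ) - 2) ^ 2 / 4 * ∫ x, ‖u x‖ ^ 2 / ‖x‖ ^ 2 ≤ ∫ x, gradNormSq u x := by
  have hN' : (3:ℝ) ≤ N := by exact_mod_cast hN
  have hd : Continuous (fderiv ℝ u) := hu.continuous_fderiv (by simp)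
  have hcu : Continuous u := hu.continuous
  have hdu : Differentiable ℝ u := hu.differentiable (by simp)
  obtain ⟨C, hC⟩ := hcu.bounded_above_of_compact_support hc
  obtain ⟨D, hD⟩ := hd.bounded_above_of_compact_support (hc.fderiv (𝕜 := ℝ))
  have hC0 : 0 ≤ C := (norm_nonneg _).trans (hC 0)
  obtain ⟨R, hR0, hR⟩ := hc.isCompact.isBounded.exists_pos_norm_lt
  have hz : ∀ x, R ≤ ‖x‖ → u x = 0 := by
    intro x hx
    by_contra h
    exact absurd (hR x (subset_tsupport _ h)) (not_lt.2 hx)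
  have hA : Integrable (fun x => ‖u x‖ ^ 2 / ‖x‖ ^ 2) := by
    refine (inv_norm_int hN 2 (by omega) (C ^ 2) R).mono' ?_ ?_
    · exact (by fun_prop : Measurable (fun x => ‖u x‖ ^ 2 / ‖x‖ ^ 2)).aestronglyMeasurable
    · apply Filter.Eventually.of_forall; intro x
      by_cases hx : ‖x‖ < R
      · rw [Set.indicator_of_mem (by simpa using hx), Real.norm_of_nonneg (by positivity)]
        gcongr; exact hC x
      · rw [hz x (not_lt.1 hx), Set.indicator_of_notMem (by simpa using hx)]; simp
  refine ⟨hA, ?_⟩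
  set F : ℝ → EuclideanSpace ℝ (Fin N) → ℝ := fun t x => ‖u (t • x)‖ ^ 2 / ‖x‖ ^ 2 with hF
  set F' : ℝ → EuclideanSpace ℝ (Fin N) → ℝ :=
    fun t x => 2 * inner ℝ (u (t • x)) (fderiv ℝ u (t • x) x) / ‖x‖ ^ 2 with hF'
  have main := hasDerivAt_integral_of_dominated_loc_of_deriv_le (μ := volume) (F := F) (F' := F')
    (x₀ := 1) (s := Metric.ball (1:ℝ) (1/2))
    (bound := (Metric.ball (0 : EuclideanSpace ℝ (Fin N)) (2 * R)).indicator
      (fun x => (2 * C * D) / ‖x‖ ^ 1))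
    (Metric.ball_mem_nhds _ (by norm_num))
    (Filter.Eventually.of_forall fun t =>
      (by fun_prop : Measurable (fun x => ‖u (t • x)‖ ^ 2 / ‖x‖ ^ 2)).aestronglyMeasurable)
    (by simpa [hF] using hA)
    (by
      have h1 : Continuous (fun x : EuclideanSpace ℝ (Fin N) =>
        2 * inner ℝ (u ((1:ℝ) • x)) (fderiv ℝ u ((1:ℝ) • x) x)) := by fun_prop
      exact (h1.measurable.div (by fun_prop)).aestronglyMeasurable)
    (by
      apply Filter.Eventually.of_forall; intro x t ht
      rw [Metric.mem_ball, Real.dist_eq, abs_lt] at ht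
      have ht0 : 1/2 < t := by linarith [ht.1]
      by_cases hx : ‖x‖ < 2 * R
      · rw [Set.indicator_of_mem (by simpa using hx)]
        simp only [hF']
        rcases eq_or_ne x 0 with h0 | h0
        · simp [h0]
        have hx0 : 0 < ‖x‖ := norm_pos_iff.2 h0
        have h1 : |inner ℝ (u (t • x)) (fderiv ℝ u (t • x) x)| ≤ C * (D * ‖x‖) := by
          refine (abs_real_inner_le_norm _ _).trans ?_
          gcongr
          · exact hC _
          · exact ((fderiv ℝ u (t • x)).le_opNorm x).trans (by gcongr; exact hD _)
        rw [norm_div, norm_mul, Real.norm_eq_abs (inner ℝ _ _), Real.norm_of_nonneg (by positivity : (0:ℝ) ≤ ‖x‖ ^ 2), Real.norm_of_nonneg (by norm_num : (0:ℝ) ≤ 2), div_le_div_iff₀ (by positivity) (by positivity)]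
        nlinarith
      · rw [Set.indicator_of_notMem (by simpa using hx)]
        have : u (t • x) = 0 := by
          apply hz
          rw [norm_smul, Real.norm_of_nonneg (by linarith)]
          nlinarith
        simp [hF', this])
    (inv_norm_int hN 1 (by omega) _ _)
    (by
      apply Filter.Eventually.of_forall; intro x t _
      have h1 : HasDerivAt (fun t : ℝ => t • x) x t := by
        simpa using (hasDerivAt_id t).smul_const x
      have h2 : HasDerivAt (fun t : ℝ => u (t • x)) (fderiv ℝ u (t • x) x) t :=
        (hdu (t • x)).hasFDerivAt.comp_hasDerivAt t h1
      exact h2.norm_sq.div_const _)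
  obtain ⟨hi', hder⟩ := main
  set A : ℝ := ∫ x, ‖u x‖ ^ 2 / ‖x‖ ^ 2 with hAdef
  have hder2 : HasDerivAt (fun t => ∫ x, F t x) ((2 - (N:ℝ)) * A) 1 := by
    have h1 : HasDerivAt (fun t : ℝ => t ^ (2 - (N:ℝ)) * A) ((2 - (N:ℝ)) * A) 1 := by
      have := (Real.hasDerivAt_rpow_const (x := 1) (p := 2 - (N:ℝ)) (Or.inl one_ne_zero)).mul_const A
      simpa using this
    refine h1.congr_of_eventuallyEq ?_
    filter_upwards [lt_mem_nhds (zero_lt_one (α := ℝ))] with t ht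
    have h2 : ∀ x, F t x = t ^ 2 * (‖u (t • x)‖ ^ 2 / ‖t • x‖ ^ 2) := by
      intro x
      simp only [hF]
      rw [norm_smul, Real.norm_of_nonneg ht.le]
      rcases eq_or_ne (‖x‖) 0 with h | h
      · simp [h]
      · field_simp
    simp_rw [h2, integral_const_mul]
    rw [int_dil ht (fun x => ‖u x‖ ^ 2 / ‖x‖ ^ 2), ← mul_assoc, ← Real.rpow_natCast t 2,
      ← Real.rpow_add ht]
    congr 2
  have heq := hder.unique hder2
  set r : ℝ := ((N:ℝ) - 2) / 2 with hr
  have hr0 : 0 < r := by rw [hr]; linarith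
  have hpt : ∀ x, -F' 1 x ≤ r * (‖u x‖ ^ 2 / ‖x‖ ^ 2) + r⁻¹ * gradNormSq u x := by
    intro x
    simp only [hF', one_smul]
    have hg0 : 0 ≤ gradNormSq u x := Finset.sum_nonneg fun i _ => by positivity
    rcases eq_or_ne x 0 with h0 | h0
    · subst h0; simp; positivity
    have hx0 : 0 < ‖x‖ := norm_pos_iff.2 h0
    have h1 := abs_real_inner_le_norm (u x) (fderiv ℝ u x x)
    have h2 := grad_bound u x x
    have h3 : -(2 * inner ℝ (u x) (fderiv ℝ u x x)) ≤
        r * ‖u x‖ ^ 2 + r⁻¹ * (gradNormSq u x * ‖x‖ ^ 2) := by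
      have h4 : r⁻¹ * ‖fderiv ℝ u x x‖ ^ 2 ≤ r⁻¹ * (gradNormSq u x * ‖x‖ ^ 2) := by gcongr
      have h5 : 2 * (‖u x‖ * ‖fderiv ℝ u x x‖) ≤ r * ‖u x‖ ^ 2 + r⁻¹ * ‖fderiv ℝ u x x‖ ^ 2 := by
        have : r * ‖u x‖ ^ 2 + r⁻¹ * ‖fderiv ℝ u x x‖ ^ 2 - 2 * (‖u x‖ * ‖fderiv ℝ u x x‖)
          = r⁻¹ * (r * ‖u x‖ - ‖fderiv ℝ u x x‖) ^ 2 := by field_simp; ring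
        have : 0 ≤ r⁻¹ * (r * ‖u x‖ - ‖fderiv ℝ u x x‖) ^ 2 := by positivity
        linarith
      linarith [neg_abs_le (inner ℝ (u x) (fderiv ℝ u x x))]
    have h6 := div_le_div_of_nonneg_right h3 (by positivity : (0:ℝ) ≤ ‖x‖ ^ 2)
    have h7 : (r * ‖u x‖ ^ 2 + r⁻¹ * (gradNormSq u x * ‖x‖ ^ 2)) / ‖x‖ ^ 2 =
        r * (‖u x‖ ^ 2 / ‖x‖ ^ 2) + r⁻¹ * gradNormSq u x := by field_simp
    rw [h7] at h6
    rwa [neg_div] at h6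
  have hG := grad_integrable hu hc
  have hfin := integral_mono hi'.neg ((hA.const_mul r).add (hG.const_mul r⁻¹)) hpt
  simp only [Pi.neg_apply, Pi.add_apply] at hfin
  rw [integral_neg, integral_add (hA.const_mul r) (hG.const_mul r⁻¹), integral_const_mul,
    integral_const_mul, heq, ← hAdef] at hfin
  have h8 : r * A ≤ r⁻¹ * ∫ x, gradNormSq u x := by
    have : -((2 - (N:ℝ)) * A) = 2 * (r * A) := by rw [hr]; ring
    linarith
  have h9 := mul_le_mul_of_nonneg_left h8 hr0.le
  rw [← mul_assoc, ← mul_assoc, mul_inv_cancel₀ hr0.ne', one_mul] at h9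
  calc ((N:ℝ) - 2) ^ 2 / 4 * A = r * r * A := by rw [hr]; ring
    _ ≤ _ := h9

theorem kin_pos {N : ℕ} (hN : 3 ≤ N) {lam : ℝ} (hlam : -(((N : ℝ) - 2) ^ 2 / 4) < lam)
    {u : EuclideanSpace ℝ (Fin N) → ℂ}
    (hu : ContDiff ℝ (⊤ : ℕ∞) u) (hc : HasCompactSupport u) (h0 : u ≠ 0) :
    0 < kineticK lam u := by
  obtain ⟨hA, hH⟩ := hardy hN hu hc
  have hnn : ∀ x, 0 ≤ ‖u x‖ ^ 2 / ‖x‖ ^ 2 := fun x => by positivity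
  have hpos : 0 < ∫ x, ‖u x‖ ^ 2 / ‖x‖ ^ 2 := by
    refine lt_of_le_of_ne (integral_nonneg hnn) fun h => h0 ?_
    have h1 := (integral_eq_zero_iff_of_nonneg hnn hA).1 h.symm
    have : Nontrivial (EuclideanSpace ℝ (Fin N)) := by
      apply Module.nontrivial_of_finrank_pos (R := ℝ); simp; omega
    have h2 : u =ᵐ[volume] 0 := by
      filter_upwards [h1, Measure.ae_ne volume (0 : EuclideanSpace ℝ (Fin N))] with x hx hx0
      simpa [hx0] using hx
    exact (Continuous.ae_eq_iff_eq volume hu.continuous continuous_const).1 h2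
  unfold kineticK
  nlinarith

/-- **Refined coercivity below the mountain-pass level, inverse-square potential
Hartree case.** -/
theorem virial_coercivity (N : ℕ) (hN : 3 ≤ N) (α τ lam p B : ℝ)
    (hα : 0 < α) (hαN : α < N) (hlam : -(((N : ℝ) - 2) ^ 2 / 4) < lam)
    (hτ : 0 < τ) (hτN : τ < N) (hcnd : 0 < 2 - 2 * τ + α)
    (hp1 : 1 + α / N < p) (hp2 : p < 1 + (2 - 2 * τ + α) / ((N : ℝ) - 2))
    (hB : B = N * p - N - α + 2 * τ) (hB2 : 2 < B)
    (hm : 0 < mpLevel N α τ lam p B) (σ : ℝ) (hσ : σ < mpLevel N α τ lam p B) :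
    ∃ ε > 0, ∀ u : EuclideanSpace ℝ (Fin N) → ℂ,
      ContDiff ℝ (⊤ : ℕ∞) u → HasCompactSupport u → u ≠ 0 →
      virialI α τ lam p B u < 0 → actionS α τ lam p u ≤ σ →
      virialI α τ lam p B u + ε * kineticK lam u ≤
        -(B / 4) * (mpLevel N α τ lam p B - actionS α τ lam p u) := by
  have hp0 : 0 < p := by
    have : 0 ≤ α / N := by positivity
    linarith
  obtain ⟨ε, hε, H⟩ := real_core hB2 hσ
  refine ⟨ε, hε, fun u hu hc h0 hI hS => ?_⟩
  have hIeq : ∀ v : EuclideanSpace ℝ (Fin N) → ℂ, virialI α τ lam p B v =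
      kineticK lam v - (B / 2) * (hartreeP α τ p v / p) := by
    intro v; unfold virialI; field_simp
  have hSeq : ∀ v : EuclideanSpace ℝ (Fin N) → ℂ, actionS α τ lam p v =
      kineticK lam v + (∫ x, ‖v x‖ ^ 2) - hartreeP α τ p v / p := by
    intro v; unfold actionS; ring
  rw [hIeq] at hI ⊢
  rw [hSeq] at hS ⊢
  refine H _ _ _ (kin_pos hN hlam hu hc h0) (integral_nonneg fun x => by positivity) hI hS ?_
  intro s hs0 hs1 hs
  have hbdd : BddBelow {s : ℝ | ∃ v : EuclideanSpace ℝ (Fin N) → ℂ,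
      ContDiff ℝ (⊤ : ℕ∞) v ∧ HasCompactSupport v ∧ v ≠ 0 ∧
      virialI α τ lam p B v = 0 ∧ s = actionS α τ lam p v} := by
    by_contra h
    unfold mpLevel at hm
    rw [Real.sInf_of_not_bddBelow h] at hm
    exact lt_irrefl _ hm
  have hP := hartree_dil hs0 α τ p u
  rw [← hB] at hP
  refine csInf_le hbdd ⟨dil s u, dil_smooth s hu, dil_supp hs0 hc, dil_ne hs0 h0, ?_, ?_⟩
  · rw [hIeq, kin_dil hs0, hP, ← hs]; ring
  · rw [hSeq, kin_dil hs0, hP, mass_dil hs0]; ring
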